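/- arXiv:2108.07680 — 2 statements merged into one kernel-verified Lean document; each statement's English description precedes it below -/
import Mathlib

section
/- Let r ≥ 2 and d ≥ 2 be integers. There exists an indexed family of hyperplanes H_{i,j} in ℝ^d, for i ∈ Fin(d+1) and j ∈ Fin r, such that the whole family of r(d+1) hyperplanes is in general position, and such that for every choice of permutations σ₁, …, σ_{d+1} of Fin r there exist indices j ≠ j' in Fin r for which the simplex induced by the d+1 hyperplanes {H_{i, σ_i(j)} : i ∈ Fin(d+1)} is disjoint from the simplex induced by {H_{i, σ_i(j')} : i ∈ Fin(d+1)}. -/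
/-- The hyperplane `{x ∈ ℝ^d : ⟨v, x⟩ = c}`. -/
def hplaneSet (d : ℕ) (v : Fin d → ℝ) (c : ℝ) : Set (Fin d → ℝ) :=
  {x | ∑ m, v m * x m = c}

/-- An indexed family of hyperplanes `⟨v i, x⟩ = c i` in `ℝ^d` is in general position
if the normal vectors of any `d` of them are linearly independent and no `d+1` of
them have a common point. -/
def InGeneralPosition (d : ℕ) {ι : Type*} (v : ι → Fin d → ℝ) (c : ι → ℝ) : Prop :=
  (∀ g : Fin d → ι, Function.Injective g →
    LinearIndependent ℝ (fun m => v (g m))) ∧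
  (∀ g : Fin (d + 1) → ι, Function.Injective g →
    ¬∃ x : Fin d → ℝ, ∀ m, x ∈ hplaneSet d (v (g m)) (c (g m)))

/-- The simplex induced by `d+1` hyperplanes in general position: the convex hull of
the `d+1` points obtained as the common point of all hyperplanes but one. -/
noncomputable def inducedSimplex (d : ℕ) (v : Fin (d + 1) → Fin d → ℝ)
    (c : Fin (d + 1) → ℝ) : Set (Fin d → ℝ) :=
  convexHull ℝ
    {x | ∃ k : Fin (d + 1), ∀ i : Fin (d + 1), i ≠ k → x ∈ hplaneSet d (v i) (c i)}

open Filter Topology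

/-- `det (A + ε B)` is nonzero for small nonzero `ε` if `det B ≠ 0`. -/
lemma eventually_det_ne {n : ℕ} (A B : Matrix (Fin n) (Fin n) ℝ) (hB : B.det ≠ 0) :
    ∀ᶠ ε : ℝ in 𝓝[≠] 0, (A + ε • B).det ≠ 0 := by
  set P : Polynomial ℝ :=
    Matrix.det ((Polynomial.X : Polynomial ℝ) • B.map Polynomial.C + A.map Polynomial.C) with hP
  have hP0 : P ≠ 0 := by
    intro h
    have := Polynomial.coeff_det_X_add_C_card B A
    rw [← hP, h] at this
    exact hB (by simpa using this.symm)
  have hev : ∀ ε : ℝ, P.eval ε = (A + ε • B).det := by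
    intro ε
    rw [hP, ← Polynomial.coe_evalRingHom, RingHom.map_det]
    congr 1
    ext i j
    simp [add_comm]
    ring
  have hfin : ({x | P.IsRoot x} : Set ℝ).Finite := Polynomial.finite_setOfPred_isRoot hP0
  have h2 : ∀ᶠ ε : ℝ in 𝓝[≠] 0, ε ∉ {x | P.IsRoot x} \ {0} := by
    have : IsClosed ({x | P.IsRoot x} \ {0} : Set ℝ) := (hfin.subset Set.sdiff_subset).isClosed
    exact nhdsWithin_le_nhds (this.isOpen_compl.mem_nhds (by simp))
  filter_upwards [h2, self_mem_nhdsWithin] with ε h h'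
  rw [← hev]
  intro h3
  exact h ⟨h3, h'⟩

/-- Strict one-sided bounds on the induced simplex persist under perturbation. -/
lemma eventually_simplex_lt {d : ℕ} (V0 V1 : Fin (d + 1) → Fin d → ℝ) (C0 C1 : Fin (d + 1) → ℝ)
    (hns : ∀ k : Fin (d + 1), ∀ x : Fin d → ℝ, (∀ i, i ≠ k → ∑ m, V0 i m * x m = 0) → x = 0)
    (f : (Fin d → ℝ) →ₗ[ℝ] ℝ) (u : ℝ)
    (h : ∀ k : Fin (d + 1), ∀ x : Fin d → ℝ, (∀ i, i ≠ k → ∑ m, V0 i m * x m = C0 i) → f x < u) :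
    ∀ᶠ ε : ℝ in 𝓝 0,
      ∀ x ∈ inducedSimplex d (fun i => V0 i + ε • V1 i) (fun i => C0 i + ε * C1 i), f x < u := by
  have key : ∀ k : Fin (d + 1), ∀ᶠ ε : ℝ in 𝓝 0, ∀ x : Fin d → ℝ,
      (∀ i, i ≠ k → x ∈ hplaneSet d (V0 i + ε • V1 i) (C0 i + ε * C1 i)) → f x < u := by
    intro k
    let M : ℝ → Matrix (Fin d) (Fin d) ℝ := fun ε =>
      Matrix.of fun a m => V0 (k.succAbove a) m + ε * V1 (k.succAbove a) m
    let b : ℝ → Fin d → ℝ := fun ε a => C0 (k.succAbove a) + ε * C1 (k.succAbove a)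
    have hM : Continuous M := by
      refine continuous_matrix fun i j => ?_
      simp only [M, Matrix.of_apply]
      fun_prop
    have hb : Continuous b := by
      refine continuous_pi fun i => ?_
      simp only [b]
      fun_prop
    have hdet : (M 0).det ≠ 0 := by
      intro h0
      obtain ⟨x, hx, hx0⟩ := Matrix.exists_mulVec_eq_zero_iff.2 h0
      apply hx
      apply hns k
      intro i hi
      obtain ⟨a, rfl⟩ := Fin.exists_succAbove_eq hi
      have := congrFun hx0 a
      simpa [M, Matrix.mulVec, dotProduct] using this
    have hdc : Continuous fun ε => (M ε).det := hM.matrix_det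
    have hsol : ContinuousAt (fun ε => f (((M ε).det)⁻¹ • ((M ε).adjugate.mulVec (b ε)))) 0 := by
      have hf : Continuous f := f.continuous_of_finiteDimensional
      refine hf.continuousAt.comp ?_
      refine ContinuousAt.smul (hdc.continuousAt.inv₀ hdet) ?_
      exact (hM.matrix_adjugate.matrix_mulVec hb).continuousAt
    have hval : ∀ ε, (M ε).det ≠ 0 → ∀ x : Fin d → ℝ, (M ε).mulVec x = b ε →
        x = ((M ε).det)⁻¹ • ((M ε).adjugate.mulVec (b ε)) := by
      intro ε hε x hx
      rw [← hx, Matrix.mulVec_mulVec, Matrix.adjugate_mul, Matrix.smul_mulVec, Matrix.one_mulVec,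
        smul_smul, inv_mul_cancel₀ hε, one_smul]
    have h0 : f (((M 0).det)⁻¹ • ((M 0).adjugate.mulVec (b 0))) < u := by
      apply h k
      intro i hi
      obtain ⟨a, rfl⟩ := Fin.exists_succAbove_eq hi
      have : (M 0).mulVec (((M 0).det)⁻¹ • ((M 0).adjugate.mulVec (b 0))) = b 0 := by
        rw [Matrix.mulVec_smul, Matrix.mulVec_mulVec, Matrix.mul_adjugate, Matrix.smul_mulVec,
          Matrix.one_mulVec, smul_smul, inv_mul_cancel₀ hdet, one_smul]
      have := congrFun this a
      simpa [M, b, Matrix.mulVec, dotProduct] using this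
    filter_upwards [hsol.eventually_lt_const h0, hdc.continuousAt.eventually_ne hdet]
      with ε h1 h2 x hx
    rw [hval ε h2 x ?_]
    · exact h1
    · ext a
      have := hx (k.succAbove a) (Fin.succAbove_ne k a)
      simpa [hplaneSet, M, b, Matrix.mulVec, dotProduct] using this
  filter_upwards [eventually_all.2 key] with ε hε x hx
  have : inducedSimplex d (fun i => V0 i + ε • V1 i) (fun i => C0 i + ε * C1 i) ⊆ {x | f x < u} := by
    refine convexHull_min ?_ (convex_halfSpace_lt f.isLinear u)
    rintro y ⟨k, hk⟩
    exact hε k y hk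
  exact this hx

/-- A perturbation of any family along the moment curve is in general position. -/
lemma eventually_gp {d : ℕ} {ι : Type} [Finite ι] (v : ι → Fin d → ℝ) (c t : ι → ℝ)
    (ht : Function.Injective t) :
    ∀ᶠ ε : ℝ in 𝓝[≠] 0, InGeneralPosition d
      (fun p => v p + ε • (fun m : Fin d => t p ^ (m : ℕ))) (fun p => c p + ε * t p ^ d) := by
  have h1 : ∀ g : Fin d → ι, ∀ᶠ ε : ℝ in 𝓝[≠] 0, Function.Injective g →
      LinearIndependent ℝ (fun m => v (g m) + ε • (fun k : Fin d => t (g m) ^ (k : ℕ))) := by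
    intro g
    by_cases hg : Function.Injective g
    · have hv := Matrix.det_vandermonde_ne_zero_iff.2 (ht.comp hg)
      filter_upwards [eventually_det_ne (Matrix.of fun m => v (g m)) _ hv] with ε hε _
      have := Matrix.linearIndependent_rows_of_det_ne_zero hε
      exact this
    · exact Eventually.of_forall fun _ h => absurd h hg
  have h2 : ∀ g : Fin (d + 1) → ι, ∀ᶠ ε : ℝ in 𝓝[≠] 0, Function.Injective g →
      ¬∃ x : Fin d → ℝ, ∀ m, x ∈ hplaneSet d
        (v (g m) + ε • (fun k : Fin d => t (g m) ^ (k : ℕ))) (c (g m) + ε * t (g m) ^ d) := by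
    intro g
    by_cases hg : Function.Injective g
    · have hv := Matrix.det_vandermonde_ne_zero_iff.2 (ht.comp hg)
      filter_upwards [eventually_det_ne
        (Matrix.of fun m => (Fin.snoc (v (g m)) (c (g m)) : Fin (d + 1) → ℝ)) _ hv] with ε hε _
      rintro ⟨x, hx⟩
      apply hε
      rw [← Matrix.exists_mulVec_eq_zero_iff]
      refine ⟨Fin.snoc x (-1), ?_, ?_⟩
      · intro h
        have := congrFun h (Fin.last d)
        simp at this
      · ext m
        have := hx m
        simp only [hplaneSet, Set.mem_ofPred_eq, Pi.add_apply, Pi.smul_apply, smul_eq_mul] at this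
        simp [Matrix.mulVec, dotProduct, Fin.sum_univ_castSucc, Matrix.vandermonde_apply, this]
    · exact Eventually.of_forall fun _ h => absurd h hg
  filter_upwards [eventually_all.2 h1, eventually_all.2 h2] with ε a b
  exact ⟨a, b⟩

/-- Normals of the unperturbed configuration. -/
noncomputable def baseV (n : ℕ) (r : ℕ) (i : Fin (n + 3)) (j : Fin r) : Fin (n + 2) → ℝ :=
  Fin.cases (Fin.cons (if (j : ℕ) = 0 then 1 / 2 else -1) (Fin.cons 1 (fun _ => -1)))
    (Fin.cases (Fin.cons 0 (Fin.cons 1 (fun _ => 0)))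
      (Fin.cases (Fin.cons 1 (Fin.cons 0 (fun _ => 0)))
        (fun k => Fin.cons 0 (Fin.cons 0 (Pi.single k 1))))) i

/-- Offsets of the unperturbed configuration. -/
noncomputable def baseC (n : ℕ) (r : ℕ) (i : Fin (n + 3)) (j : Fin r) : ℝ :=
  Fin.cases 0 (Fin.cases (if (j : ℕ) = 0 then -1 else 1)
    (Fin.cases (if (j : ℕ) = 0 then 3 else -3) (fun _ => 0))) i

lemma val2 (n : ℕ) : 2 % (n + 3) = 2 := Nat.mod_eq_of_lt (by omega)

lemma base_eqs (n r : ℕ) (s : Fin (n + 3) → Fin r) (x : Fin (n + 2) → ℝ) (C : Fin (n + 3) → ℝ)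
    (k : Fin (n + 3)) (h : ∀ i, i ≠ k → ∑ m, baseV n r i (s i) m * x m = C i) :
    (0 ≠ k → (if (s 0 : ℕ) = 0 then 1 / 2 else -1) * x 0 + x 1 - ∑ m : Fin n, x m.succ.succ = C 0) ∧
    (1 ≠ k → x 1 = C 1) ∧ (2 ≠ k → x 0 = C 2) ∧
    (∀ m : Fin n, m.succ.succ.succ ≠ k → x m.succ.succ = C m.succ.succ.succ) := by
  refine ⟨fun hk => ?_, fun hk => ?_, fun hk => ?_, fun m hk => ?_⟩
  · have := h _ hk
    rw [Fin.sum_univ_succ, Fin.sum_univ_succ] at this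
    simp [baseV] at this
    simp
    linarith
  · have := h _ hk
    have e : baseV n r 1 (s 1) = Fin.cons 0 (Fin.cons 1 (fun _ => 0)) := rfl
    rw [e, Fin.sum_univ_succ, Fin.sum_univ_succ] at this
    simpa using this
  · have := h _ hk
    have e : baseV n r 2 (s 2) = Fin.cons 1 (Fin.cons 0 (fun _ => 0)) := rfl
    rw [e, Fin.sum_univ_succ, Fin.sum_univ_succ] at this
    simpa using this
  · have := h _ hk
    rw [Fin.sum_univ_succ, Fin.sum_univ_succ] at this
    simpa [baseV, Pi.single_apply] using this

lemma base_cases {n : ℕ} (k : Fin (n + 3)) :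
    k = 0 ∨ k = 1 ∨ k = 2 ∨ ∃ m : Fin n, k = m.succ.succ.succ := by
  refine Fin.cases (Or.inl rfl) (fun k => Or.inr ?_) k
  refine Fin.cases (Or.inl rfl) (fun k => Or.inr ?_) k
  exact Fin.cases (Or.inl rfl) (fun k => Or.inr ⟨k, rfl⟩) k

lemma base_ns (n r : ℕ) (s : Fin (n + 3) → Fin r) (k : Fin (n + 3)) (x : Fin (n + 2) → ℝ)
    (h : ∀ i, i ≠ k → ∑ m, baseV n r i (s i) m * x m = 0) : x = 0 := by
  obtain ⟨ha, hb, hc, hy⟩ := base_eqs n r s x (fun _ => 0) k h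
  have fin : x 0 = 0 → x 1 = 0 → (∀ m : Fin n, x m.succ.succ = 0) → x = 0 := by
    intro h0 h1 h2
    ext i
    refine Fin.cases h0 (fun i => ?_) i
    exact Fin.cases h1 (fun i => h2 i) i
  rcases base_cases k with rfl | rfl | rfl | ⟨m, rfl⟩
  · exact fin (hc (by rw [Ne, Fin.ext_iff]; simp [val2])) (hb (by simp)) (fun m => hy m (by rw [Ne, Fin.ext_iff]; simp [val2]))
  · have h2 := fun m => hy m (by rw [Ne, Fin.ext_iff]; simp [val2])
    have h0 := hc (by rw [Ne, Fin.ext_iff]; simp [val2])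
    have h1 := ha (by simp)
    simp [h2, h0] at h1
    exact fin h0 h1 h2
  · have h2 := fun m => hy m (by rw [Ne, Fin.ext_iff]; simp [val2])
    have h1 := hb (by rw [Ne, Fin.ext_iff]; simp [val2])
    have h0 := ha (by rw [Ne, Fin.ext_iff]; simp [val2])
    simp [h2, h1] at h0
    refine fin ?_ h1 h2
    split_ifs at h0 <;> simpa using h0
  · have h0 := hc (by rw [Ne, Fin.ext_iff]; simp [val2])
    have h1 := hb (by rw [Ne, Fin.ext_iff]; simp [val2])
    have h2 : ∀ m' : Fin n, m' ≠ m → x m'.succ.succ = 0 := fun m' hm =>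
      hy m' (by simpa [Fin.ext_iff] using hm)
    have h3 := ha (by rw [Ne, Fin.ext_iff]; simp [val2])
    rw [Finset.sum_eq_single m (fun b _ hb => h2 b hb) (by simp)] at h3
    refine fin h0 h1 fun m' => ?_
    by_cases e : m' = m
    · subst e
      simp [h0, h1] at h3
      exact h3
    · exact h2 m' e

/-- The first two coordinates of every vertex are those of a vertex of a planar triangle. -/
lemma base_vertex (n r : ℕ) (s : Fin (n + 3) → Fin r) (k : Fin (n + 3)) (x : Fin (n + 2) → ℝ)
    (h : ∀ i, i ≠ k → ∑ m, baseV n r i (s i) m * x m = baseC n r i (s i)) :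
    (x 0 = (if (s 2 : ℕ) = 0 then 3 else -3) ∧ x 1 = (if (s 1 : ℕ) = 0 then -1 else 1)) ∨
    ((if (s 0 : ℕ) = 0 then 1 / 2 else -1) * x 0 + x 1 = 0 ∧
      (x 0 = (if (s 2 : ℕ) = 0 then 3 else -3) ∨ x 1 = (if (s 1 : ℕ) = 0 then -1 else 1))) := by
  obtain ⟨ha, hb, hc, hy⟩ := base_eqs n r s x (fun i => baseC n r i (s i)) k h
  have e1 : baseC n r 1 (s 1) = (if (s 1 : ℕ) = 0 then -1 else 1) := rfl
  have e2 : baseC n r 2 (s 2) = (if (s 2 : ℕ) = 0 then 3 else -3) := rfl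
  have e0 : baseC n r 0 (s 0) = 0 := rfl
  have e3 : ∀ m : Fin n, baseC n r m.succ.succ.succ (s m.succ.succ.succ) = 0 := fun m => rfl
  simp only [e0, e1, e2, e3] at ha hb hc hy
  rcases base_cases k with rfl | rfl | rfl | ⟨m, rfl⟩
  · exact Or.inl ⟨hc (by rw [Ne, Fin.ext_iff]; simp [val2]), hb (by simp)⟩
  · have h2 := fun m => hy m (by rw [Ne, Fin.ext_iff]; simp [val2])
    have h1 := ha (by simp)
    rw [Finset.sum_eq_zero (fun m _ => h2 m), sub_zero] at h1
    exact Or.inr ⟨h1, Or.inl (hc (by rw [Ne, Fin.ext_iff]; simp [val2]))⟩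
  · have h2 := fun m => hy m (by rw [Ne, Fin.ext_iff]; simp [val2])
    have h1 := ha (by rw [Ne, Fin.ext_iff]; simp [val2])
    rw [Finset.sum_eq_zero (fun m _ => h2 m), sub_zero] at h1
    exact Or.inr ⟨h1, Or.inr (hb (by rw [Ne, Fin.ext_iff]; simp [val2]))⟩
  · exact Or.inl ⟨hc (by rw [Ne, Fin.ext_iff]; simp [val2]), hb (by rw [Ne, Fin.ext_iff]; simp [val2])⟩

/-- Two parts of the base configuration are strictly separated by a linear functional. -/
def SepBase (n r : ℕ) (s s' : Fin (n + 3) → Fin r) : Prop :=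
  ∃ (f : (Fin (n + 2) → ℝ) →ₗ[ℝ] ℝ) (u : ℝ),
    (∀ k : Fin (n + 3), ∀ x : Fin (n + 2) → ℝ,
      (∀ i, i ≠ k → ∑ m, baseV n r i (s i) m * x m = baseC n r i (s i)) → f x < u) ∧
    (∀ k : Fin (n + 3), ∀ x : Fin (n + 2) → ℝ,
      (∀ i, i ≠ k → ∑ m, baseV n r i (s' i) m * x m = baseC n r i (s' i)) → u < f x)

lemma exists_sep (n r : ℕ) (hr : 2 ≤ r) (σ : Fin (n + 3) → Equiv.Perm (Fin r)) :
    ∃ j j' : Fin r, j ≠ j' ∧ SepBase n r (fun i => σ i j) (fun i => σ i j') := by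
  let z : Fin r := ⟨0, by omega⟩
  have hz : ∀ i j, ((σ i j : Fin r) : ℕ) = 0 ↔ j = (σ i).symm z := by
    intro i j
    rw [Equiv.eq_symm_apply, Fin.ext_iff]
  let X : (Fin (n + 2) → ℝ) →ₗ[ℝ] ℝ := LinearMap.proj 0
  let Z : (Fin (n + 2) → ℝ) →ₗ[ℝ] ℝ := LinearMap.proj 1
  have hX : ∀ x, X x = x 0 := fun _ => rfl
  have hW : ∀ x, (Z + (1 / 2 : ℝ) • X) x = x 1 + 1 / 2 * x 0 := fun _ => rfl
  by_cases h1 : (σ 0).symm z = (σ 1).symm z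
  · by_cases h2 : (σ 2).symm z = (σ 0).symm z
    · obtain ⟨j', hj'⟩ : ∃ j' : Fin r, j' ≠ (σ 0).symm z := by
        have : Nontrivial (Fin r) := Fin.nontrivial_iff_two_le.2 hr
        exact exists_ne _
      refine ⟨j', (σ 0).symm z, hj', X, 3 / 2, ?_, ?_⟩ <;> intro k x h <;>
        have := base_vertex n r _ k x h <;>
        simp only [hz, h2, ← h1, hj', if_true, if_false] at this <;> rw [hX] <;>
        rcases this with ⟨a, b⟩ | ⟨a, b | b⟩ <;> linarith
    · refine ⟨(σ 0).symm z, (σ 2).symm z, Ne.symm h2, Z + (1 / 2 : ℝ) • X, 1, ?_, ?_⟩ <;>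
        intro k x h <;> have := base_vertex n r _ k x h <;>
        simp only [hz, h2, ← h1, Ne.symm h2, if_true, if_false] at this <;> rw [hW] <;>
        rcases this with ⟨a, b⟩ | ⟨a, b | b⟩ <;> linarith
  · by_cases h2 : (σ 2).symm z = (σ 1).symm z
    · refine ⟨(σ 0).symm z, (σ 1).symm z, h1, X, -(3 / 2), ?_, ?_⟩ <;>
        intro k x h <;> have := base_vertex n r _ k x h <;>
        simp only [hz, h2, h1, Ne.symm h1, if_true, if_false] at this <;> rw [hX] <;>
        rcases this with ⟨a, b⟩ | ⟨a, b | b⟩ <;> linarith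
    · refine ⟨(σ 1).symm z, (σ 0).symm z, Ne.symm h1, Z + (1 / 2 : ℝ) • X, -1, ?_, ?_⟩ <;>
        intro k x h <;> have := base_vertex n r _ k x h <;>
        simp only [hz, Ne.symm h2, h1, Ne.symm h1, if_true, if_false] at this <;> rw [hW] <;>
        rcases this with ⟨a, b⟩ | ⟨a, b | b⟩ <;> (try split_ifs at *) <;> linarith

/-- For every `r ≥ 2` and `d ≥ 2` there are `d+1` families of `r` hyperplanes in
`ℝ^d`, in general position, such that every colorful partition (encoded by
permutations `σ i` of `Fin r`, the `j`-th part being `{H (i, σ i j) : i}`) has two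
parts whose induced simplices are disjoint. -/
theorem stmt5 (r d : ℕ) (hr : 2 ≤ r) (hd : 2 ≤ d) :
    ∃ (v : Fin (d + 1) → Fin r → Fin d → ℝ) (c : Fin (d + 1) → Fin r → ℝ),
      (∀ i j, v i j ≠ 0) ∧
      InGeneralPosition d (fun p : Fin (d + 1) × Fin r => v p.1 p.2)
        (fun p : Fin (d + 1) × Fin r => c p.1 p.2) ∧
      ∀ σ : Fin (d + 1) → Equiv.Perm (Fin r),
        ∃ j j' : Fin r, j ≠ j' ∧
          Disjoint
            (inducedSimplex d (fun i => v i (σ i j)) (fun i => c i (σ i j)))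
            (inducedSimplex d (fun i => v i (σ i j')) (fun i => c i (σ i j'))) := by
  obtain ⟨n, rfl⟩ : ∃ n, d = n + 2 := ⟨d - 2, by omega⟩
  obtain ⟨t, ht⟩ : ∃ t : Fin (n + 2 + 1) × Fin r → ℝ, Function.Injective t := by
    let e := Fintype.equivFin (Fin (n + 2 + 1) × Fin r)
    exact ⟨fun p => ((e p : ℕ) : ℝ), fun p q h => e.injective (Fin.ext (Nat.cast_injective (R := ℝ) h))⟩
  let w : Fin (n + 2 + 1) → Fin r → Fin (n + 2) → ℝ := fun i j m => t (i, j) ^ (m : ℕ)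
  let e : Fin (n + 2 + 1) → Fin r → ℝ := fun i j => t (i, j) ^ (n + 2)
  have hgp := eventually_gp (fun p : Fin (n + 2 + 1) × Fin r => baseV n r p.1 p.2)
    (fun p => baseC n r p.1 p.2) t ht
  have hne : ∀ i j, ∀ᶠ ε : ℝ in 𝓝[≠] 0, baseV n r i j + ε • w i j ≠ 0 := by
    intro i j
    apply nhdsWithin_le_nhds
    have hc : Continuous fun ε : ℝ => baseV n r i j + ε • w i j := by fun_prop
    refine hc.continuousAt.eventually_ne ?_
    simp only [zero_smul, add_zero]
    intro h0
    rcases base_cases i with rfl | rfl | rfl | ⟨m, rfl⟩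
    · have : (1 : ℝ) = 0 := congrFun h0 1
      exact one_ne_zero this
    · have : (1 : ℝ) = 0 := congrFun h0 1
      exact one_ne_zero this
    · have : (1 : ℝ) = 0 := congrFun h0 0
      exact one_ne_zero this
    · have : (Pi.single m 1 : Fin n → ℝ) m = 0 := congrFun h0 m.succ.succ
      simp at this
  have hsep : ∀ σ : Fin (n + 2 + 1) → Equiv.Perm (Fin r), ∀ᶠ ε : ℝ in 𝓝[≠] 0,
      ∃ j j' : Fin r, j ≠ j' ∧ Disjoint
        (inducedSimplex (n + 2) (fun i => baseV n r i (σ i j) + ε • w i (σ i j))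
          (fun i => baseC n r i (σ i j) + ε * e i (σ i j)))
        (inducedSimplex (n + 2) (fun i => baseV n r i (σ i j') + ε • w i (σ i j'))
          (fun i => baseC n r i (σ i j') + ε * e i (σ i j'))) := by
    intro σ
    obtain ⟨j, j', hj, f, u, h1, h2⟩ := exists_sep n r hr σ
    have E1 := eventually_simplex_lt (fun i => baseV n r i (σ i j)) (fun i => w i (σ i j))
      (fun i => baseC n r i (σ i j)) (fun i => e i (σ i j))
      (fun k x h => base_ns n r _ k x h) f u h1
    have E2 := eventually_simplex_lt (fun i => baseV n r i (σ i j')) (fun i => w i (σ i j'))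
      (fun i => baseC n r i (σ i j')) (fun i => e i (σ i j'))
      (fun k x h => base_ns n r _ k x h) (-f) (-u)
      (fun k x h => by simpa using h2 k x h)
    apply nhdsWithin_le_nhds
    filter_upwards [E1, E2] with ε a b
    refine ⟨j, j', hj, Set.disjoint_left.2 fun x hx hx' => ?_⟩
    have p := a x hx
    have q := b x hx'
    simp only [LinearMap.neg_apply] at q
    linarith
  obtain ⟨ε, hg, hn, hs⟩ := (hgp.and ((eventually_all.2 fun i => eventually_all.2 (hne i)).and
    (eventually_all.2 hsep))).exists
  exact ⟨fun i j => baseV n r i j + ε • w i j, fun i j => baseC n r i j + ε * e i j, hn, hg, hs⟩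
end

section
/- Let r ≥ 1 be any integer. For every family of 3r lines in the plane ℝ² in general position, there exists a partition of the family into r triples of lines, and a point p ∈ ℝ², such that p belongs to the triangle induced by every one of the r triples. -/
open Filter Topology in
/-- Continuous `r`-th smallest value among finitely many continuous functions. -/
theorem aux_kth {ι : Type*} [DecidableEq ι] (l : ι → ℝ → ℝ) (hl : ∀ i, Continuous (l i))
    (S : Finset ι) (r : ℕ) (hr : 1 ≤ r) (hS : r ≤ S.card) :
    ∃ f : ℝ → ℝ, Continuous f ∧
      (∀ x y, f x ≤ y ↔ r ≤ (S.filter (fun i => l i x ≤ y)).card) ∧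
      (∀ x y, f x < y ↔ r ≤ (S.filter (fun i => l i x < y)).card) := by
  classical
  let F : Finset ι → ℝ → ℝ := fun T x =>
    if h : T.Nonempty then T.sup' h (fun i => l i x) else 0
  have hF : ∀ T, Continuous (F T) := by
    intro T
    by_cases h : T.Nonempty
    · simp only [F, h, dif_pos]
      exact Continuous.finset_sup'_apply h (fun i _ => hl i)
    · simp only [F, h]
      exact continuous_const
  have hne : (S.powersetCard r).Nonempty := Finset.powersetCard_nonempty.2 hS
  have hTne : ∀ T ∈ S.powersetCard r, T.Nonempty := by
    intro T hT
    rw [Finset.mem_powersetCard] at hT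
    exact Finset.card_pos.1 (by omega)
  refine ⟨fun x => (S.powersetCard r).inf' hne (fun T => F T x),
    Continuous.finset_inf'_apply hne (fun T _ => hF T), ?_, ?_⟩
  · intro x y
    rw [Finset.inf'_le_iff]
    constructor
    · rintro ⟨T, hT, h⟩
      have h0 := hTne T hT
      simp only [F, h0, dif_pos, Finset.sup'_le_iff] at h
      rw [Finset.mem_powersetCard] at hT
      rw [← hT.2]
      exact Finset.card_le_card fun i hi => Finset.mem_filter.2 ⟨hT.1 hi, h i hi⟩
    · intro h
      obtain ⟨T, hT, hc⟩ := Finset.exists_subset_card_eq h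
      have hT' : T ∈ S.powersetCard r :=
        Finset.mem_powersetCard.2 ⟨hT.trans (Finset.filter_subset _ _), hc⟩
      refine ⟨T, hT', ?_⟩
      have h0 := hTne T hT'
      simp only [F, h0, dif_pos, Finset.sup'_le_iff]
      exact fun i hi => (Finset.mem_filter.1 (hT hi)).2
  · intro x y
    rw [Finset.inf'_lt_iff]
    constructor
    · rintro ⟨T, hT, h⟩
      have h0 := hTne T hT
      simp only [F, h0, dif_pos, Finset.sup'_lt_iff] at h
      rw [Finset.mem_powersetCard] at hT
      rw [← hT.2]
      exact Finset.card_le_card fun i hi => Finset.mem_filter.2 ⟨hT.1 hi, h i hi⟩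
    · intro h
      obtain ⟨T, hT, hc⟩ := Finset.exists_subset_card_eq h
      have hT' : T ∈ S.powersetCard r :=
        Finset.mem_powersetCard.2 ⟨hT.trans (Finset.filter_subset _ _), hc⟩
      refine ⟨T, hT', ?_⟩
      have h0 := hTne T hT'
      simp only [F, h0, dif_pos, Finset.sup'_lt_iff]
      exact fun i hi => (Finset.mem_filter.1 (hT hi)).2

/-- Far away comparison: if pointwise `A > B > C` then the `A ∪ B` quantile exceeds the
`C ∪ B` quantile. -/
theorem aux_far {ι : Type*} [DecidableEq ι] (A B C : Finset ι) (r : ℕ) (hr : 1 ≤ r)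
    (hB : B.card = r) (hC : C.card = r) (u : ι → ℝ) (F G : ℝ)
    (hF : ∀ y, F ≤ y ↔ r ≤ ((A ∪ B).filter (fun i => u i ≤ y)).card)
    (hG : ∀ y, G < y ↔ r ≤ ((C ∪ B).filter (fun i => u i < y)).card)
    (hAB : ∀ i ∈ A, ∀ j ∈ B, u j < u i) (hBC : ∀ i ∈ B, ∀ j ∈ C, u j < u i) : G < F := by
  by_contra hcon
  have hcon : F ≤ G := not_lt.1 hcon
  have h1 : ∀ i ∈ B, G < u i := by
    intro i hi
    by_contra h
    have : G < G := by
      rw [hG, ← hC]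
      refine Finset.card_le_card fun j hj => Finset.mem_filter.2 ⟨Finset.mem_union_left _ hj, ?_⟩
      exact (hBC i hi j hj).trans_le (not_lt.1 h)
    exact lt_irrefl _ this
  obtain ⟨b, hb⟩ : B.Nonempty := Finset.card_pos.1 (by omega)
  rw [hF] at hcon
  obtain ⟨i, hi⟩ : ((A ∪ B).filter (fun i => u i ≤ G)).Nonempty := Finset.card_pos.1 (by omega)
  rw [Finset.mem_filter, Finset.mem_union] at hi
  rcases hi with ⟨h | h, h2⟩
  · have := hAB i h b hb
    have := h1 b hb
    linarith
  · have := h1 i h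
    linarith

/-- Pointwise comparison near a crossing of two lines of `B`. -/
theorem aux_near_pt {ι : Type*} [DecidableEq ι] (A B C : Finset ι) (r : ℕ)
    (hBC : Disjoint B C)
    (u u0 : ι → ℝ) (y F G : ℝ)
    (hF : ∀ y, F < y ↔ r ≤ ((A ∪ B).filter (fun i => u i < y)).card)
    (hG : ∀ y, G ≤ y ↔ r ≤ ((C ∪ B).filter (fun i => u i ≤ y)).card)
    (j k : ι) (hj : j ∈ B) (hj0 : u0 j = y) (hjk : u j < u k)
    (hlo : ∀ i, u0 i < y → u i < u j)
    (hhi : ∀ i ∈ A ∪ B, u0 i ≤ y → i = j ∨ i = k ∨ u0 i < y)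
    (hup : ∀ i, y < u0 i → u k < u i)
    (hcA : (A.filter (fun i => u0 i < y)).card + (B.filter (fun i => u0 i < y)).card + 2 = r)
    (hcC : (C.filter (fun i => u0 i < y)).card + (B.filter (fun i => u0 i < y)).card + 1 = r) :
    G < F := by
  have h1 : G ≤ u j := by
    rw [hG, ← hcC]
    have hd : Disjoint (C.filter (fun i => u0 i < y)) (B.filter (fun i => u0 i < y)) :=
      Finset.disjoint_filter_filter hBC.symm
    rw [← Finset.card_union_of_disjoint hd]
    have hjn : j ∉ C.filter (fun i => u0 i < y) ∪ B.filter (fun i => u0 i < y) := by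
      simp [hj0]
    rw [← Finset.card_insert_of_notMem hjn]
    refine Finset.card_le_card fun i hi => ?_
    simp only [Finset.mem_insert, Finset.mem_union, Finset.mem_filter] at hi ⊢
    rcases hi with rfl | ⟨h, h'⟩ | ⟨h, h'⟩
    · exact ⟨Or.inr hj, le_rfl⟩
    · exact ⟨Or.inl h, (hlo i h').le⟩
    · exact ⟨Or.inr h, (hlo i h').le⟩
  have h2 : u k ≤ F := by
    by_contra h
    have h := (hF _).1 (not_le.1 h)
    have hsub : (A ∪ B).filter (fun i => u i < u k) ⊆
        insert j (A.filter (fun i => u0 i < y) ∪ B.filter (fun i => u0 i < y)) := by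
      intro i hi
      rw [Finset.mem_filter] at hi
      obtain ⟨hi, hik⟩ := hi
      have h3 : u0 i ≤ y := by
        by_contra h3
        have := hup i (not_le.1 h3)
        linarith
      rcases hhi i hi h3 with rfl | rfl | h4
      · simp
      · exact absurd hik (lt_irrefl _)
      · simp only [Finset.mem_insert, Finset.mem_union, Finset.mem_filter] at hi ⊢
        tauto
    have h5 := Finset.card_le_card hsub
    have h6 := Finset.card_insert_le j
      (A.filter (fun i => u0 i < y) ∪ B.filter (fun i => u0 i < y))
    have h7 := Finset.card_union_le (A.filter (fun i => u0 i < y)) (B.filter (fun i => u0 i < y))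
    omega
  linarith

open Filter Topology in
/-- Local comparison near a crossing of two lines of `B`. -/
theorem aux_near {ι : Type*} [DecidableEq ι] [Finite ι] (m b : ι → ℝ)
    (hm : Function.Injective m) (A B C : Finset ι) (r : ℕ)
    (hBC : Disjoint B C) (f g : ℝ → ℝ)
    (hf : ∀ x y, f x < y ↔ r ≤ ((A ∪ B).filter (fun i => m i * x + b i < y)).card)
    (hg : ∀ x y, g x ≤ y ↔ r ≤ ((C ∪ B).filter (fun i => m i * x + b i ≤ y)).card)
    (x0 y : ℝ) (j k : ι) (hj : j ∈ B) (hk : k ∈ B) (hjk : j ≠ k)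
    (hj0 : m j * x0 + b j = y) (hk0 : m k * x0 + b k = y)
    (hoth : ∀ i ∈ A ∪ B, m i * x0 + b i = y → i = j ∨ i = k)
    (hcA : (A.filter (fun i => m i * x0 + b i < y)).card +
      (B.filter (fun i => m i * x0 + b i < y)).card + 2 = r)
    (hcC : (C.filter (fun i => m i * x0 + b i < y)).card +
      (B.filter (fun i => m i * x0 + b i < y)).card + 1 = r) :
    ∀ᶠ x in 𝓝 x0, x ≠ x0 → g x < f x := by
  have hc : ∀ i, ContinuousAt (fun x => m i * x + b i) x0 := fun i => by fun_prop
  have h1 : ∀ q, m q * x0 + b q = y → ∀ i, ∀ᶠ x in 𝓝 x0,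
      (m i * x0 + b i < y → m i * x + b i < m q * x + b q) ∧
      (y < m i * x0 + b i → m q * x + b q < m i * x + b i) := by
    intro q hq i
    rcases lt_trichotomy (m i * x0 + b i) y with h | h | h
    · have := (hc i).eventually_lt (hc q) (by simpa [hq] using h)
      filter_upwards [this] with x hx
      exact ⟨fun _ => hx, fun h' => absurd h' (not_lt.2 h.le)⟩
    · filter_upwards with x
      exact ⟨fun h' => absurd h' (by simp [h]), fun h' => absurd h' (by simp [h])⟩
    · have := (hc q).eventually_lt (hc i) (by simpa [hq] using h)
      filter_upwards [this] with x hx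
      exact ⟨fun h' => absurd h' (not_lt.2 h.le), fun _ => hx⟩
  have hJ := eventually_all.2 (h1 j hj0)
  have hK := eventually_all.2 (h1 k hk0)
  filter_upwards [hJ, hK] with x hJ hK hx
  have hne : m j * x + b j ≠ m k * x + b k := by
    intro h
    have : (m j - m k) * (x - x0) = 0 := by linarith
    rcases mul_eq_zero.1 this with h | h
    · exact hjk (hm (by linarith))
    · exact hx (by linarith)
  rcases lt_or_gt_of_ne hne with h | h
  · exact aux_near_pt A B C r hBC (fun i => m i * x + b i) (fun i => m i * x0 + b i) y _ _
      (hf x) (hg x) j k hj hj0 h (fun i hi => (hJ i).1 hi)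
      (fun i hi hle => by
        rcases hle.lt_or_eq with h | h
        · exact Or.inr (Or.inr h)
        · rcases hoth i hi h with h | h <;> simp [h])
      (fun i hi => (hK i).2 hi) hcA hcC
  · exact aux_near_pt A B C r hBC (fun i => m i * x + b i) (fun i => m i * x0 + b i) y _ _
      (hf x) (hg x) k j hk hk0 h (fun i hi => (hK i).1 hi)
      (fun i hi hle => by
        rcases hle.lt_or_eq with h | h
        · exact Or.inr (Or.inr h)
        · rcases hoth i hi h with h | h <;> simp [h])
      (fun i hi => (hJ i).2 hi) hcA hcC

open Filter Topology in
/-- For lines with smaller slope, eventually smaller values. -/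
theorem aux_top {m b m' b' : ℝ} (h : m < m') : ∀ᶠ x in atTop, m * x + b < m' * x + b' := by
  filter_upwards [eventually_gt_atTop ((b - b') / (m' - m))] with x hx
  rw [div_lt_iff₀ (by linarith)] at hx
  linarith

open Filter Topology in
theorem aux_bot {m b m' b' : ℝ} (h : m < m') : ∀ᶠ x in atBot, m' * x + b' < m * x + b := by
  filter_upwards [eventually_lt_atBot ((b - b') / (m' - m))] with x hx
  rw [lt_div_iff₀ (by linarith)] at hx
  linarith

open Filter Topology in
/-- The combinatorial core. -/
theorem aux_core {ι : Type*} [DecidableEq ι] [Finite ι] (m b : ι → ℝ)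
    (hm : Function.Injective m)
    (hgen : ∀ i j k, i ≠ j → i ≠ k → j ≠ k → ∀ x y,
      ¬(m i * x + b i = y ∧ m j * x + b j = y ∧ m k * x + b k = y))
    (A B C : Finset ι) (r : ℕ) (hr : 1 ≤ r)
    (hA : A.card = r) (hB : B.card = r) (hC : C.card = r)
    (hAB : ∀ i ∈ A, ∀ j ∈ B, m i < m j) (hBC : ∀ i ∈ B, ∀ j ∈ C, m i < m j) :
    ∃ x y : ℝ, ∃ DA DB DC : Finset ι,
      ((∀ i ∈ A, (i ∈ DA → m i * x + b i ≤ y) ∧ (i ∉ DA → y ≤ m i * x + b i)) ∧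
       (∀ i ∈ B, (i ∈ DB → m i * x + b i ≤ y) ∧ (i ∉ DB → y ≤ m i * x + b i)) ∧
       (∀ i ∈ C, (i ∈ DC → m i * x + b i ≤ y) ∧ (i ∉ DC → y ≤ m i * x + b i))) ∧
      (DA ⊆ A ∧ DB ⊆ B ∧ DC ⊆ C) ∧
      DA.card + DB.card = r ∧ DC.card + DB.card = r := by
  classical
  have hne : B.Nonempty := Finset.card_pos.1 (by omega)
  have dAB : Disjoint A B := Finset.disjoint_left.2 fun i h h' => lt_irrefl _ (hAB i h i h')
  have dBC : Disjoint B C := Finset.disjoint_left.2 fun i h h' => lt_irrefl _ (hBC i h i h')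
  have dAC : Disjoint A C := Finset.disjoint_left.2 fun i h h' => by
    obtain ⟨j, hj⟩ := hne
    exact lt_irrefl _ ((hAB i h j hj).trans (hBC j hj i h'))
  have hlc : ∀ i, Continuous (fun x => m i * x + b i) := fun i => by fun_prop
  obtain ⟨f, fc, fle, flt⟩ := aux_kth (fun i x => m i * x + b i) hlc (A ∪ B) r hr
    (hA ▸ Finset.card_le_card Finset.subset_union_left)
  obtain ⟨g, gc, gle, glt⟩ := aux_kth (fun i x => m i * x + b i) hlc (C ∪ B) r hr
    (hC ▸ Finset.card_le_card Finset.subset_union_left)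
  -- behaviour at infinity
  have htop : ∀ᶠ x in atTop, f x < g x := by
    have h : ∀ᶠ x in atTop, ∀ i j, m i < m j → m i * x + b i < m j * x + b j := by
      refine eventually_all.2 fun i => eventually_all.2 fun j => ?_
      by_cases h : m i < m j
      · exact (aux_top h).mono fun x hx _ => hx
      · exact Eventually.of_forall fun x hx => absurd hx h
    filter_upwards [h] with x h
    exact aux_far C B A r hr hB hA (fun i => m i * x + b i) _ _ (gle x) (flt x)
      (fun i hi j hj => h _ _ (hBC j hj i hi)) (fun i hi j hj => h _ _ (hAB j hj i hi))
  have hbot : ∀ᶠ x in atBot, g x < f x := by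
    have h : ∀ᶠ x in atBot, ∀ i j, m i < m j → m j * x + b j < m i * x + b i := by
      refine eventually_all.2 fun i => eventually_all.2 fun j => ?_
      by_cases h : m i < m j
      · exact (aux_bot h).mono fun x hx _ => hx
      · exact Eventually.of_forall fun x hx => absurd hx h
    filter_upwards [h] with x h
    exact aux_far A B C r hr hB hC (fun i => m i * x + b i) _ _ (fle x) (glt x)
      (fun i hi j hj => h _ _ (hAB i hi j hj)) (fun i hi j hj => h _ _ (hBC i hi j hj))
  -- crossing point
  set E : Set ℝ := {x | g x < f x} with hE
  have hEne : E.Nonempty := hbot.exists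
  have hEbd : BddAbove E := by
    obtain ⟨X, hX⟩ := eventually_atTop.1 htop
    refine ⟨X, fun x hx => ?_⟩
    by_contra h
    exact lt_asymm hx (hX x (not_le.1 h).le)
  obtain ⟨x0, hx0⟩ : ∃ x0, IsLUB E x0 := ⟨_, isLUB_csSup hEne hEbd⟩
  have hright : ∀ x, x0 < x → f x ≤ g x := by
    intro x hx
    by_contra h
    exact absurd (hx0.1 (not_le.1 h : x ∈ E)) (not_le.2 hx)
  have hge : g x0 ≤ f x0 := by
    have hcl : IsClosed {x | g x ≤ f x} := isClosed_le gc fc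
    have : x0 ∈ closure E := hx0.mem_closure hEne
    have hsub : E ⊆ {x | g x ≤ f x} := by
      intro x hx
      have hx' : g x < f x := hx
      exact hx'.le
    exact closure_minimal hsub hcl this
  have hle : f x0 ≤ g x0 := by
    have hcl : IsClosed {x | f x ≤ g x} := isClosed_le fc gc
    have : x0 ∈ closure (Set.Ioi x0) := by simp
    exact closure_minimal hright hcl this
  have hxE : x0 ∉ E := fun h => absurd hle (not_le.2 h)
  have notev1 : ¬ ∀ᶠ x in 𝓝 x0, x ≠ x0 → g x < f x := by
    intro h
    have h' : ∀ᶠ x in 𝓝[>] x0, x ≠ x0 → g x < f x := h.filter_mono nhdsWithin_le_nhds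
    obtain ⟨x, hx, hx'⟩ := (h'.and self_mem_nhdsWithin).exists
    exact absurd (hright x hx') (not_le.2 (hx (ne_of_gt hx')))
  have notev2 : ¬ ∀ᶠ x in 𝓝 x0, x ≠ x0 → f x < g x := by
    intro h
    have : x0 ∈ closure E := hx0.mem_closure hEne
    rw [mem_closure_iff_frequently] at this
    obtain ⟨x, hx, hx'⟩ := (this.and_eventually h).exists
    exact lt_asymm hx (hx' (fun h => hxE (h ▸ hx)))
  obtain ⟨y, hy⟩ : ∃ y, y = f x0 := ⟨_, rfl⟩
  have hyg : y = g x0 := hy.trans (le_antisymm hle hge)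
  -- counts
  have cf1 := (fle x0 y).1 hy.ge
  have cf2 := mt (flt x0 y).2 (not_lt.2 hy.le)
  have cg1 := (gle x0 y).1 hyg.ge
  have cg2 := mt (glt x0 y).2 (not_lt.2 hyg.le)
  have split : ∀ S : Finset ι, (S.filter (fun i => m i * x0 + b i ≤ y)).card =
      (S.filter (fun i => m i * x0 + b i < y)).card +
      (S.filter (fun i => m i * x0 + b i = y)).card := by
    intro S
    rw [← Finset.card_union_of_disjoint, ← Finset.filter_or]
    · congr 1
      ext i
      simp [le_iff_lt_or_eq]
    · exact Finset.disjoint_filter.2 fun i _ h h' => ne_of_lt h h'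
  have un : ∀ (S T : Finset ι) (p : ι → Prop) [DecidablePred p], Disjoint S T →
      ((S ∪ T).filter p).card = (S.filter p).card + (T.filter p).card := by
    intro S T p _ h
    rw [Finset.filter_union, Finset.card_union_of_disjoint (Finset.disjoint_filter_filter h)]
  rw [un _ _ _ dAB] at cf1 cf2
  rw [un _ _ _ dBC.symm] at cg1 cg2
  have hN : (((A ∪ B) ∪ C).filter (fun i => m i * x0 + b i = y)).card ≤ 2 := by
    by_contra h
    obtain ⟨i, hi, j, hj, k, hk, h1, h2, h3⟩ := Finset.two_lt_card.1 (not_le.1 h)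
    exact hgen i j k h1 h2 h3 x0 y ⟨(Finset.mem_filter.1 hi).2, (Finset.mem_filter.1 hj).2,
      (Finset.mem_filter.1 hk).2⟩
  have hN2 := hN
  rw [un _ _ _ (Finset.disjoint_union_left.2 ⟨dAC, dBC⟩), un _ _ _ dAB] at hN2
  have sA := split A
  have sB := split B
  have sC := split C
  -- the exceptional configuration
  have hexc : (B.filter (fun i => m i * x0 + b i = y)).card = 2 →
      (A.filter (fun i => m i * x0 + b i < y)).card =
      (C.filter (fun i => m i * x0 + b i < y)).card := by
    intro h2
    obtain ⟨j, k, hjk, hjkE⟩ := Finset.card_eq_two.1 h2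
    have hj : j ∈ B.filter (fun i => m i * x0 + b i = y) := by rw [hjkE]; simp
    have hk : k ∈ B.filter (fun i => m i * x0 + b i = y) := by rw [hjkE]; simp
    rw [Finset.mem_filter] at hj hk
    have hothB : ∀ i ∈ B, m i * x0 + b i = y → i = j ∨ i = k := by
      intro i hi h
      have : i ∈ B.filter (fun i => m i * x0 + b i = y) := Finset.mem_filter.2 ⟨hi, h⟩
      rw [hjkE] at this
      simpa using this
    have hothA : ∀ S : Finset ι, (S.filter (fun i => m i * x0 + b i = y)).card = 0 →
        ∀ i ∈ S ∪ B, m i * x0 + b i = y → i = j ∨ i = k := by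
      intro S hS i hi h
      rcases Finset.mem_union.1 hi with h' | h'
      · rw [Finset.card_eq_zero] at hS
        have : i ∈ S.filter (fun i => m i * x0 + b i = y) := Finset.mem_filter.2 ⟨h', h⟩
        rw [hS] at this
        simp at this
      · exact hothB i h' h
    by_contra hcon
    rcases lt_or_gt_of_ne hcon with h | h
    · exact notev1 (aux_near m b hm A B C r dBC f g flt gle x0 y j k hj.1 hk.1 hjk hj.2 hk.2
        (hothA A (by omega)) (by omega) (by omega))
    · exact notev2 (aux_near m b hm C B A r dAB.symm g f glt fle x0 y j k hj.1 hk.1 hjk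
        hj.2 hk.2 (hothA C (by omega)) (by omega) (by omega))
  -- choose target cardinalities
  have key : ∃ a β : ℕ, a + β = r ∧
      (A.filter (fun i => m i * x0 + b i < y)).card ≤ a ∧
      a ≤ (A.filter (fun i => m i * x0 + b i ≤ y)).card ∧
      (B.filter (fun i => m i * x0 + b i < y)).card ≤ β ∧
      β ≤ (B.filter (fun i => m i * x0 + b i ≤ y)).card ∧
      (C.filter (fun i => m i * x0 + b i < y)).card ≤ a ∧
      a ≤ (C.filter (fun i => m i * x0 + b i ≤ y)).card := by
    generalize (A.filter (fun i => m i * x0 + b i < y)).card = a1 at *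
    generalize (B.filter (fun i => m i * x0 + b i < y)).card = b1 at *
    generalize (C.filter (fun i => m i * x0 + b i < y)).card = c1 at *
    generalize (A.filter (fun i => m i * x0 + b i ≤ y)).card = a2 at *
    generalize (B.filter (fun i => m i * x0 + b i ≤ y)).card = b2 at *
    generalize (C.filter (fun i => m i * x0 + b i ≤ y)).card = c2 at *
    generalize (A.filter (fun i => m i * x0 + b i = y)).card = a3 at *
    generalize (B.filter (fun i => m i * x0 + b i = y)).card = b3 at *
    generalize (C.filter (fun i => m i * x0 + b i = y)).card = c3 at *
    refine ⟨max (max a1 c1) (r - b2), r - max (max a1 c1) (r - b2), ?_⟩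
    clear fle flt gle glt
    omega
  obtain ⟨a, β, hab, ha1, ha2, hb1, hb2, hc1, hc2⟩ := key
  have mono : ∀ S : Finset ι, S.filter (fun i => m i * x0 + b i < y) ⊆
      S.filter (fun i => m i * x0 + b i ≤ y) := fun S i hi => by
    rw [Finset.mem_filter] at hi ⊢
    exact ⟨hi.1, hi.2.le⟩
  have pick : ∀ (S : Finset ι) (n : ℕ), (S.filter (fun i => m i * x0 + b i < y)).card ≤ n →
      n ≤ (S.filter (fun i => m i * x0 + b i ≤ y)).card →
      ∃ D : Finset ι, (∀ i ∈ S, (i ∈ D → m i * x0 + b i ≤ y) ∧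
        (i ∉ D → y ≤ m i * x0 + b i)) ∧ D ⊆ S ∧ D.card = n := by
    intro S n h1 h2
    obtain ⟨D, h3, h4, h5⟩ := Finset.exists_subsuperset_card_eq (mono S) h1 h2
    refine ⟨D, fun i hi => ⟨fun h => (Finset.mem_filter.1 (h4 h)).2, fun h => ?_⟩,
      h4.trans (Finset.filter_subset _ _), h5⟩
    by_contra h'
    exact h (h3 (Finset.mem_filter.2 ⟨hi, not_le.1 h'⟩))
  obtain ⟨DA, pA, qA, kA⟩ := pick A a ha1 ha2
  obtain ⟨DB, pB, qB, kB⟩ := pick B β hb1 hb2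
  obtain ⟨DC, pC, qC, kC⟩ := pick C a hc1 hc2
  exact ⟨x0, y, DA, DB, DC, ⟨pA, pB, pC⟩, ⟨qA, qB, qC⟩, by omega, by omega⟩

/-- A permutation matching two predicates with the same number of elements. -/
theorem aux_match {α : Type*} [Fintype α] (P Q : α → Prop) [DecidablePred P] [DecidablePred Q]
    (h : Fintype.card {x // P x} = Fintype.card {x // Q x}) :
    ∃ e : α ≃ α, ∀ x, Q (e x) ↔ P x := by
  have h' : Fintype.card {x // ¬ P x} = Fintype.card {x // ¬ Q x} := by
    rw [Fintype.card_subtype_compl, Fintype.card_subtype_compl, h]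
  let e1 := Fintype.equivOfCardEq h
  let e2 := Fintype.equivOfCardEq h'
  refine ⟨Equiv.subtypeCongr e1 e2, fun x => ?_⟩
  by_cases hx : P x
  · simp only [Equiv.subtypeCongr, Equiv.trans_apply, Equiv.sumCompl_symm_apply_of_pos hx, hx,
      iff_true]
    exact (e1 ⟨x, hx⟩).2
  · simp only [Equiv.subtypeCongr, Equiv.trans_apply, Equiv.sumCompl_symm_apply_of_neg hx, hx,
      iff_false]
    exact (e2 ⟨x, hx⟩).2

/-- A point with alternating position relative to three lines lies in their triangle. -/
theorem aux_tri (v : Fin 3 → Fin 2 → ℝ) (c : Fin 3 → ℝ) (t : ℝ) (m b : Fin 3 → ℝ)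
    (hl : ∀ i x y, (![x + t * y, y] : Fin 2 → ℝ) ∈ hplaneSet 2 (v i) (c i) ↔ m i * x + b i = y)
    (h01 : m 0 < m 1) (h12 : m 1 < m 2) (x y : ℝ)
    (hgen : ¬(m 0 * x + b 0 = y ∧ m 1 * x + b 1 = y ∧ m 2 * x + b 2 = y))
    (hpos : (m 0 * x + b 0 ≤ y ∧ y ≤ m 1 * x + b 1 ∧ m 2 * x + b 2 ≤ y) ∨
      (y ≤ m 0 * x + b 0 ∧ m 1 * x + b 1 ≤ y ∧ y ≤ m 2 * x + b 2)) :
    (![x + t * y, y] : Fin 2 → ℝ) ∈ inducedSimplex 2 v c := by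
  obtain ⟨e0, he0⟩ : ∃ e, e = y - (m 0 * x + b 0) := ⟨_, rfl⟩
  obtain ⟨e1, he1⟩ : ∃ e, e = y - (m 1 * x + b 1) := ⟨_, rfl⟩
  obtain ⟨e2, he2⟩ : ∃ e, e = y - (m 2 * x + b 2) := ⟨_, rfl⟩
  have p0 : 0 < m 2 - m 1 := by linarith
  have p1 : 0 < m 2 - m 0 := by linarith
  have p2 : 0 < m 1 - m 0 := by linarith
  obtain ⟨D, hD⟩ : ∃ D, D = (m 2 - m 1) * e0 + (m 2 - m 0) * (-e1) + (m 1 - m 0) * e2 :=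
    ⟨_, rfl⟩
  have hsign : D ≠ 0 ∧ 0 ≤ (m 2 - m 1) * e0 / D ∧ 0 ≤ (m 2 - m 0) * (-e1) / D ∧
      0 ≤ (m 1 - m 0) * e2 / D := by
    rcases hpos with ⟨h0, h1, h2⟩ | ⟨h0, h1, h2⟩
    · have a0 : 0 ≤ (m 2 - m 1) * e0 := mul_nonneg p0.le (by linarith)
      have a1 : 0 ≤ (m 2 - m 0) * (-e1) := mul_nonneg p1.le (by linarith)
      have a2 : 0 ≤ (m 1 - m 0) * e2 := mul_nonneg p2.le (by linarith)
      have hD0 : 0 ≤ D := by linarith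
      refine ⟨fun h => hgen ?_, div_nonneg a0 hD0, div_nonneg a1 hD0, div_nonneg a2 hD0⟩
      have z0 : (m 2 - m 1) * e0 = 0 := by linarith
      have z1 : (m 2 - m 0) * (-e1) = 0 := by linarith
      have z2 : (m 1 - m 0) * e2 = 0 := by linarith
      have w0 := (mul_eq_zero.1 z0).resolve_left p0.ne'
      have w1 := (mul_eq_zero.1 z1).resolve_left p1.ne'
      have w2 := (mul_eq_zero.1 z2).resolve_left p2.ne'
      exact ⟨by linarith, by linarith, by linarith⟩
    · have a0 : (m 2 - m 1) * e0 ≤ 0 := mul_nonpos_of_nonneg_of_nonpos p0.le (by linarith)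
      have a1 : (m 2 - m 0) * (-e1) ≤ 0 := mul_nonpos_of_nonneg_of_nonpos p1.le (by linarith)
      have a2 : (m 1 - m 0) * e2 ≤ 0 := mul_nonpos_of_nonneg_of_nonpos p2.le (by linarith)
      have hD0 : D ≤ 0 := by linarith
      refine ⟨fun h => hgen ?_, div_nonneg_of_nonpos a0 hD0, div_nonneg_of_nonpos a1 hD0,
        div_nonneg_of_nonpos a2 hD0⟩
      have z0 : (m 2 - m 1) * e0 = 0 := by linarith
      have z1 : (m 2 - m 0) * (-e1) = 0 := by linarith
      have z2 : (m 1 - m 0) * e2 = 0 := by linarith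
      have w0 := (mul_eq_zero.1 z0).resolve_left p0.ne'
      have w1 := (mul_eq_zero.1 z1).resolve_left p1.ne'
      have w2 := (mul_eq_zero.1 z2).resolve_left p2.ne'
      exact ⟨by linarith, by linarith, by linarith⟩
  obtain ⟨hD0, n0, n1, n2⟩ := hsign
  -- the vertices
  obtain ⟨X0, hX0⟩ : ∃ X, X = (b 1 - b 2) / (m 2 - m 1) := ⟨_, rfl⟩
  obtain ⟨X1, hX1⟩ : ∃ X, X = (b 0 - b 2) / (m 2 - m 0) := ⟨_, rfl⟩
  obtain ⟨X2, hX2⟩ : ∃ X, X = (b 0 - b 1) / (m 1 - m 0) := ⟨_, rfl⟩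
  rw [eq_div_iff p0.ne'] at hX0
  rw [eq_div_iff p1.ne'] at hX1
  rw [eq_div_iff p2.ne'] at hX2
  have v0 : (![X0 + t * (m 1 * X0 + b 1), m 1 * X0 + b 1] : Fin 2 → ℝ) ∈
      inducedSimplex 2 v c := by
    refine subset_convexHull ℝ _ ⟨0, fun i hi => ?_⟩
    rw [hl]
    fin_cases i
    · simp at hi
    · rfl
    · show m 2 * X0 + b 2 = _
      linarith
  have v1 : (![X1 + t * (m 0 * X1 + b 0), m 0 * X1 + b 0] : Fin 2 → ℝ) ∈
      inducedSimplex 2 v c := by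
    refine subset_convexHull ℝ _ ⟨1, fun i hi => ?_⟩
    rw [hl]
    fin_cases i
    · rfl
    · simp at hi
    · show m 2 * X1 + b 2 = _
      linarith
  have v2 : (![X2 + t * (m 0 * X2 + b 0), m 0 * X2 + b 0] : Fin 2 → ℝ) ∈
      inducedSimplex 2 v c := by
    refine subset_convexHull ℝ _ ⟨2, fun i hi => ?_⟩
    rw [hl]
    fin_cases i
    · rfl
    · show m 1 * X2 + b 1 = _
      linarith
    · simp at hi
  have hconv : Convex ℝ (inducedSimplex 2 v c) := convex_convexHull ℝ _
  have hsum : (m 2 - m 1) * e0 / D + (m 2 - m 0) * (-e1) / D + (m 1 - m 0) * e2 / D = 1 := by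
    rw [← add_div, ← add_div, ← hD, div_self hD0]
  have hmem := hconv.sum_mem (t := Finset.univ)
    (w := ![(m 2 - m 1) * e0 / D, (m 2 - m 0) * (-e1) / D, (m 1 - m 0) * e2 / D])
    (z := ![![X0 + t * (m 1 * X0 + b 1), m 1 * X0 + b 1],
      ![X1 + t * (m 0 * X1 + b 0), m 0 * X1 + b 0],
      ![X2 + t * (m 0 * X2 + b 0), m 0 * X2 + b 0]])
    (by intro i _; fin_cases i; exacts [n0, n1, n2])
    (by simpa [Fin.sum_univ_three] using hsum)
    (by intro i _; fin_cases i; exacts [v0, v1, v2])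
  have hx : (m 2 - m 1) * e0 / D * X0 + (m 2 - m 0) * (-e1) / D * X1 +
      (m 1 - m 0) * e2 / D * X2 = x := by
    have : (m 2 - m 1) * e0 / D * X0 + (m 2 - m 0) * (-e1) / D * X1 +
      (m 1 - m 0) * e2 / D * X2 =
      (e0 * (X0 * (m 2 - m 1)) - e1 * (X1 * (m 2 - m 0)) + e2 * (X2 * (m 1 - m 0))) / D := by
      ring
    rw [this, hX0, hX1, hX2, div_eq_iff hD0, hD, he0, he1, he2]
    ring
  have hy : (m 2 - m 1) * e0 / D * (m 1 * X0 + b 1) + (m 2 - m 0) * (-e1) / D * (m 0 * X1 + b 0) +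
      (m 1 - m 0) * e2 / D * (m 0 * X2 + b 0) = y := by
    have : (m 2 - m 1) * e0 / D * (m 1 * X0 + b 1) +
      (m 2 - m 0) * (-e1) / D * (m 0 * X1 + b 0) + (m 1 - m 0) * e2 / D * (m 0 * X2 + b 0) =
      (e0 * (m 1 * (X0 * (m 2 - m 1)) + (m 2 - m 1) * b 1) -
        e1 * (m 0 * (X1 * (m 2 - m 0)) + (m 2 - m 0) * b 0) +
        e2 * (m 0 * (X2 * (m 1 - m 0)) + (m 1 - m 0) * b 0)) / D := by
      ring
    rw [this, hX0, hX1, hX2, div_eq_iff hD0, hD, he0, he1, he2]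
    ring
  convert hmem using 1
  ext i
  fin_cases i
  · simp [Fin.sum_univ_three]
    linear_combination -hx - t * hy
  · simp [Fin.sum_univ_three]
    linear_combination -hy

/-- Rousseeuw–Hubert: for every `r ≥ 1`, every family of `3r` lines in the plane in
general position can be partitioned into `r` triples whose induced triangles have a
common point. -/
theorem stmt7 (r : ℕ) (hr : 1 ≤ r)
    (v : Fin (r * 3) → Fin 2 → ℝ) (c : Fin (r * 3) → ℝ)
    (hv : ∀ m, v m ≠ 0)
    (hgp : InGeneralPosition 2 v c) :
    ∃ (φ : Fin (r * 3) ≃ Fin r × Fin 3) (p : Fin 2 → ℝ),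
      ∀ j : Fin r,
        p ∈ inducedSimplex 2 (fun i => v (φ.symm (j, i))) (fun i => c (φ.symm (j, i))) := by
  classical
  -- a direction in which no line is vertical
  obtain ⟨t, ht⟩ : ∃ t : ℝ, ∀ i, t * v i 0 + v i 1 ≠ 0 := by
    obtain ⟨t, ht⟩ := (Set.finite_range (fun i => -v i 1 / v i 0)).infinite_compl.nonempty
    refine ⟨t, fun i h => ?_⟩
    by_cases h0 : v i 0 = 0
    · apply hv i
      ext k
      fin_cases k
      · exact h0
      · simpa [h0] using h
    · exact ht ⟨i, by simp only; rw [div_eq_iff h0]; linarith⟩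
  obtain ⟨m, hmdef⟩ : ∃ m : Fin (r * 3) → ℝ, ∀ i, m i = -v i 0 / (t * v i 0 + v i 1) :=
    ⟨_, fun _ => rfl⟩
  obtain ⟨b, hbdef⟩ : ∃ b : Fin (r * 3) → ℝ, ∀ i, b i = c i / (t * v i 0 + v i 1) :=
    ⟨_, fun _ => rfl⟩
  have hl : ∀ i x y, (![x + t * y, y] : Fin 2 → ℝ) ∈ hplaneSet 2 (v i) (c i) ↔
      m i * x + b i = y := by
    intro i x y
    have hw := ht i
    have : m i * x + b i = (-v i 0 * x + c i) / (t * v i 0 + v i 1) := by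
      rw [hmdef, hbdef]; ring
    rw [this, div_eq_iff hw]
    simp only [hplaneSet, Set.mem_ofPred_eq, Fin.sum_univ_two, Matrix.cons_val_zero,
      Matrix.cons_val_one]
    constructor <;> intro h <;> linarith
  have hm : Function.Injective m := by
    intro i j hij
    by_contra hne
    have hinj : Function.Injective ![i, j] := by
      intro p q hpq
      fin_cases p <;> fin_cases q <;> simp_all
    have hli := hgp.1 _ hinj
    rw [hmdef, hmdef, div_eq_div_iff (ht i) (ht j)] at hij
    rw [Fintype.linearIndependent_iff] at hli
    have := hli ![t * v j 0 + v j 1, -(t * v i 0 + v i 1)] (by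
      ext k
      fin_cases k
      · simp [Fin.sum_univ_two]; linarith
      · simp [Fin.sum_univ_two]; linear_combination t * hij) 0
    exact ht j (by simpa using this)
  have hgen : ∀ i j k, i ≠ j → i ≠ k → j ≠ k → ∀ x y,
      ¬(m i * x + b i = y ∧ m j * x + b j = y ∧ m k * x + b k = y) := by
    rintro i j k hij hik hjk x y ⟨h1, h2, h3⟩
    have hinj : Function.Injective ![i, j, k] := by
      intro p q hpq
      fin_cases p <;> fin_cases q <;> simp_all
    refine hgp.2 _ hinj ⟨![x + t * y, y], fun q => ?_⟩
    rw [hl]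
    fin_cases q
    · exact h1
    · exact h2
    · exact h3
  -- sort by slope
  have hmono : StrictMono (m ∘ Tuple.sort m) :=
    (Tuple.monotone_sort m).strictMono_of_injective (hm.comp (Tuple.sort m).injective)
  obtain ⟨L, hLdef⟩ : ∃ L : Fin 3 → Fin r → Fin (r * 3), ∀ q j,
      L q j = Tuple.sort m (⟨q.1 * r + j.1, by
        have := q.2; have := j.2; nlinarith⟩ : Fin (r * 3)) := ⟨_, fun _ _ => rfl⟩
  have hLlt : ∀ q q' : Fin 3, q < q' → ∀ j j', m (L q j) < m (L q' j') := by
    intro q q' hq j j'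
    rw [hLdef, hLdef]
    refine hmono ?_
    rw [Fin.mk_lt_mk]
    have h1 : q.1 + 1 ≤ q'.1 := hq
    have h2 := j.2
    nlinarith
  have hLinj : ∀ q, Function.Injective (L q) := by
    intro q j j' h
    rw [hLdef, hLdef] at h
    have h := Fin.mk.inj ((Tuple.sort m).injective h)
    exact Fin.ext (by omega)
  obtain ⟨x, y, DA, DB, DC, ⟨pA, pB, pC⟩, ⟨qA, qB, qC⟩, k1, k2⟩ := aux_core m b hm hgen
    (Finset.univ.image (L 0)) (Finset.univ.image (L 1)) (Finset.univ.image (L 2)) r hr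
    (by rw [Finset.card_image_of_injective _ (hLinj 0)]; simp)
    (by rw [Finset.card_image_of_injective _ (hLinj 1)]; simp)
    (by rw [Finset.card_image_of_injective _ (hLinj 2)]; simp)
    (by
      intro i hi j hj
      simp only [Finset.mem_image, Finset.mem_univ, true_and] at hi hj
      obtain ⟨i, rfl⟩ := hi
      obtain ⟨j, rfl⟩ := hj
      exact hLlt 0 1 (by decide) i j)
    (by
      intro i hi j hj
      simp only [Finset.mem_image, Finset.mem_univ, true_and] at hi hj
      obtain ⟨i, rfl⟩ := hi
      obtain ⟨j, rfl⟩ := hj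
      exact hLlt 1 2 (by decide) i j)
  have hcard : ∀ q (D : Finset (Fin (r * 3))), D ⊆ Finset.univ.image (L q) →
      Fintype.card {j // L q j ∈ D} = D.card := by
    intro q D hD
    rw [Fintype.card_subtype, ← Finset.card_image_of_injective _ (hLinj q)]
    congr 1
    ext i
    simp only [Finset.mem_image, Finset.mem_filter, Finset.mem_univ, true_and]
    constructor
    · rintro ⟨j, hj, rfl⟩
      exact hj
    · intro hi
      obtain ⟨j, -, rfl⟩ := Finset.mem_image.1 (hD hi)
      exact ⟨j, hi, rfl⟩
  obtain ⟨e1, he1⟩ := aux_match (fun j => ¬ L 0 j ∈ DA) (fun j => L 1 j ∈ DB) (by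
    rw [Fintype.card_subtype_compl, hcard 0 DA qA, hcard 1 DB qB, Fintype.card_fin]
    omega)
  obtain ⟨e2, he2⟩ := aux_match (fun j => L 0 j ∈ DA) (fun j => L 2 j ∈ DC) (by
    rw [hcard 0 DA qA, hcard 2 DC qC]
    omega)
  let ψ : Fin r × Fin 3 → Fin (r * 3) := fun z =>
    L z.2 ((![Equiv.refl _, e1, e2] : Fin 3 → (Fin r ≃ Fin r)) z.2 z.1)
  have hψ : Function.Injective ψ := by
    rintro ⟨j, q⟩ ⟨j', q'⟩ h
    have hq : q = q' := by
      by_contra hne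
      rcases lt_or_gt_of_ne hne with h' | h'
      · exact absurd (congrArg m h) (hLlt _ _ h' _ _).ne
      · exact absurd (congrArg m h) (hLlt _ _ h' _ _).ne'
    subst hq
    have : j = j' := Equiv.injective _ (hLinj q h)
    rw [this]
  have hbij : Function.Bijective ψ :=
    (Fintype.bijective_iff_injective_and_card ψ).2 ⟨hψ, by simp⟩
  refine ⟨(Equiv.ofBijective ψ hbij).symm, ![x + t * y, y], fun j => ?_⟩
  simp only [Equiv.symm_symm, Equiv.ofBijective_apply]
  have memL : ∀ q i, L q i ∈ Finset.univ.image (L q) := fun q i =>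
    Finset.mem_image_of_mem _ (Finset.mem_univ _)
  refine aux_tri _ _ t (fun i => m (ψ (j, i))) (fun i => b (ψ (j, i)))
    (fun i x y => hl _ x y) (hLlt 0 1 (by decide) _ _) (hLlt 1 2 (by decide) _ _) x y
    (hgen _ _ _ (hψ.ne (by simp)) (hψ.ne (by simp)) (hψ.ne (by simp)) x y) ?_
  have a := pA (L 0 j) (memL 0 j)
  have b' := pB (L 1 (e1 j)) (memL 1 _)
  have c' := pC (L 2 (e2 j)) (memL 2 _)
  rw [he1 j] at b'
  rw [he2 j] at c'
  by_cases h : L 0 j ∈ DA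
  · exact Or.inl ⟨a.1 h, b'.2 (fun h' => h' h), c'.1 h⟩
  · exact Or.inr ⟨a.2 h, b'.1 h, c'.2 h⟩
end
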